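/- Γ₀(σ)/(σ−1) → 2√2·π/cosh(π/2) as σ → 1⁺, i.e. Γ₀(σ) is asymptotically equivalent to (2√2·π/cosh(π/2))·(σ−1) as σ → 1⁺; in particular there exists σ₀ > 1 such that Γ₀(σ) > 0 for all σ ∈ (1, σ₀). -/

import Mathlib

open MeasureTheory

/-- The cubic NLS soliton profile. -/
noncomputable def Q (y : ℝ) : ℝ := Real.sqrt 2 / Real.cosh y

/-- The explicit odd-growth solution of the linearized equation. -/
noncomputable def A (y : ℝ) : ℝ :=
  (Real.sqrt 2 / (4 * Real.cosh y)) * (3 * y * Real.tanh y + (Real.sinh y) ^ 2 - 2)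

noncomputable def T1 (σ : ℝ) (y : ℝ) : ℝ :=
  -((σ - 1) ^ 2 / (2 * (σ + 1))) * ∫ z : ℝ, |y - z| * Q z ^ (2 * σ)

noncomputable def T2 (σ : ℝ) (y : ℝ) : ℝ :=
  -(Real.sqrt 2 * σ * (σ - 1) / (4 * (σ + 1))) *
    ∫ z : ℝ, Real.exp (-(Real.sqrt 2) * |y - z|) * Q z ^ (2 * σ)

noncomputable def D0 (σ : ℝ) (y : ℝ) : ℝ :=
  -(deriv Q y) * (∫ z in (0:ℝ)..y, A z * Q z ^ (2 * σ + 1))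
    + A y * Q y ^ (2 * σ + 2) / (2 * σ + 2)

noncomputable def Delta4 (σ : ℝ) (y : ℝ) : ℝ :=
  (13 * Q y ^ 2 - 16) * Q y ^ 2 * D0 σ y
    - 8 * deriv Q y * Q y * deriv (D0 σ) y
    + 2 * Q y * (3 * (1 - Q y ^ 2) ^ 2 - 1) * T1 σ y
    + 6 * Q y * (2 - Q y ^ 2) ^ 2 * T2 σ y
    + 4 * (2 - 3 * Q y ^ 2) * deriv Q y * deriv (T1 σ) y
    + 4 * (4 - 3 * Q y ^ 2) * deriv Q y * deriv (T2 σ) y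
    + 2 * σ ^ 2 * Q y ^ (2 * σ - 1)
    - (4 * (σ + 2) / (σ + 1) + (2 * σ + 1) ^ 2) * Q y ^ (2 * σ + 1)
    + (8 / (σ + 1) + (σ + 1) * (2 * σ + 1)) * Q y ^ (2 * σ + 3)

noncomputable def Delta5 (σ : ℝ) (y : ℝ) : ℝ :=
  (2 - 30 * Q y ^ 2 + 29 * Q y ^ 4 - 8 * Q y ^ 6) * D0 σ y
    - 8 * Q y ^ 3 * deriv Q y * deriv (D0 σ) y
    + 2 * Q y * (2 - Q y ^ 2) * (2 - 3 * Q y ^ 2) * T1 σ y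
    + 2 * Q y * (3 * Q y ^ 4 - 10 * Q y ^ 2 + 12) * T2 σ y
    + 16 * (1 - Q y ^ 2) * deriv Q y * deriv (T1 σ) y
    + 8 * (2 - Q y ^ 2) * deriv Q y * deriv (T2 σ) y
    + 2 * σ * (σ + 1) * Q y ^ (2 * σ - 1)
    - (16 / (σ + 1) + 2 * σ + (2 * σ + 1) ^ 2) * Q y ^ (2 * σ + 1)
    + (4 * (4 - σ) / (σ + 1) + (σ + 1) * (2 * σ + 1)) * Q y ^ (2 * σ + 3)
    - (4 / (σ + 1)) * Q y ^ (2 * σ + 5)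

noncomputable def Gamma0 (σ : ℝ) : ℝ :=
  ∫ y : ℝ, (Q y ^ 2 * Delta4 σ y * Real.cos y
    + (2 * deriv Q y / Q y) * Delta5 σ y * Real.sin y)

open Asymptotics Filter Topology

/-- The logarithmic derivative of the soliton. -/
noncomputable def rQ (y : ℝ) : ℝ := -(Real.sinh y / Real.cosh y)

/-- The exponential weight used to control decay. -/
noncomputable def expWeight (y : ℝ) : ℝ := Real.exp (-|y| / 2)

lemma Q_pos (y : ℝ) : 0 < Q y := by
  have := Real.cosh_pos y
  unfold Q
  positivity

lemma rQ_sq (y : ℝ) : rQ y ^ 2 = 1 - Q y ^ 2 / 2 := by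
  have h := (Real.cosh_pos y).ne'
  have h2 : Real.sqrt 2 ^ 2 = 2 := Real.sq_sqrt (by norm_num)
  unfold rQ Q
  rw [div_pow, h2, neg_sq, div_pow, Real.sinh_sq]
  field_simp

lemma hasDerivAt_Q (y : ℝ) : HasDerivAt Q (rQ y * Q y) y := by
  have h := (Real.cosh_pos y).ne'
  have := (hasDerivAt_const y (Real.sqrt 2)).div (Real.hasDerivAt_cosh y) h
  refine this.congr_deriv ?_
  unfold rQ Q
  field_simp
  ring

lemma hasDerivAt_rQ (y : ℝ) : HasDerivAt rQ (-(Q y ^ 2) / 2) y := by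
  have h := (Real.cosh_pos y).ne'
  have := ((Real.hasDerivAt_sinh y).div (Real.hasDerivAt_cosh y) h).neg
  refine this.congr_deriv ?_
  have h2 : Real.sqrt 2 ^ 2 = 2 := Real.sq_sqrt (by norm_num)
  have h3 := Real.cosh_sq y
  unfold Q
  rw [div_pow, h2]
  field_simp
  linarith

lemma continuous_Q : Continuous Q :=
  continuous_iff_continuousAt.2 fun y => (hasDerivAt_Q y).continuousAt

lemma continuous_rQ : Continuous rQ :=
  continuous_iff_continuousAt.2 fun y => (hasDerivAt_rQ y).continuousAt

lemma deriv_Q : deriv Q = fun y => rQ y * Q y := funext fun y => (hasDerivAt_Q y).deriv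

lemma Q_le_sqrt_two (y : ℝ) : Q y ≤ Real.sqrt 2 :=
  div_le_self (Real.sqrt_nonneg 2) (Real.one_le_cosh y)

lemma abs_rQ_le_one (y : ℝ) : |rQ y| ≤ 1 := by
  rw [← sq_le_one_iff_abs_le_one, rQ_sq]
  have := sq_nonneg (Q y)
  linarith

lemma A_eq (y : ℝ) : A y = 1 / (2 * Q y) - 3 / 4 * (Q y + y * (rQ y * Q y)) := by
  have h := (Real.cosh_pos y).ne'
  have h2 : Real.sqrt 2 ^ 2 = 2 := Real.sq_sqrt (by norm_num)
  have h0 : Real.sqrt 2 ≠ 0 := by positivity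
  unfold A Q rQ
  rw [Real.tanh_eq_sinh_div_cosh, Real.sinh_sq]
  field_simp
  rw [h2]
  ring

/-- The derivative of `A`. -/
noncomputable def dA (y : ℝ) : ℝ :=
  -rQ y / (2 * Q y) - 3 / 4 * (2 * (rQ y * Q y) + y * (Q y - Q y ^ 3))

lemma hasDerivAt_rQ_mul_Q (y : ℝ) : HasDerivAt (fun y => rQ y * Q y) (Q y - Q y ^ 3) y := by
  refine ((hasDerivAt_rQ y).mul (hasDerivAt_Q y)).congr_deriv ?_
  linear_combination Q y * rQ_sq y

lemma hasDerivAt_A (y : ℝ) : HasDerivAt A (dA y) y := by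
  have hQ := (Q_pos y).ne'
  have h1 := ((hasDerivAt_const y (1:ℝ)).div ((hasDerivAt_Q y).const_mul 2) (by positivity)).sub
    (((hasDerivAt_Q y).add ((hasDerivAt_id y).mul (hasDerivAt_rQ_mul_Q y))).const_mul (3 / 4))
  have h2 : HasDerivAt A _ y := h1.congr_of_eventuallyEq (Eventually.of_forall fun z => A_eq z)
  refine h2.congr_deriv ?_
  simp only [dA, id]
  field_simp
  ring

lemma hasDerivAt_dA (y : ℝ) : HasDerivAt dA (A y - 3 * Q y ^ 2 * A y) y := by
  have hQ := (Q_pos y).ne'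
  have h1 := ((hasDerivAt_rQ y).neg.div ((hasDerivAt_Q y).const_mul 2) (by positivity)).sub
    ((((hasDerivAt_rQ_mul_Q y).const_mul 2).add ((hasDerivAt_id y).mul
      ((hasDerivAt_Q y).sub ((hasDerivAt_Q y).pow 3)))).const_mul (3 / 4))
  refine h1.congr_deriv ?_
  clear h1
  rw [A_eq]
  have h := rQ_sq y
  simp only [id, Pi.sub_apply, Pi.pow_apply, Pi.neg_apply]
  field_simp
  grind

/-- The Wronskian identity for `A` and the derivative of `Q`. -/
lemma wronskian (y : ℝ) : dA y * (rQ y * Q y) - (Q y - Q y ^ 3) * A y = -1 := by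
  have hQ := (Q_pos y).ne'
  have h := rQ_sq y
  rw [A_eq, dA]
  field_simp
  grind

lemma exp_neg_abs_eq_expWeight_sq (y : ℝ) : Real.exp (-|y|) = expWeight y ^ 2 := by
  rw [expWeight, ← Real.exp_nat_mul]
  congr 1
  push_cast
  ring

lemma expWeight_pos (y : ℝ) : 0 < expWeight y := Real.exp_pos _

lemma expWeight_le_one (y : ℝ) : expWeight y ≤ 1 := by
  rw [expWeight, Real.exp_le_one_iff]
  have := abs_nonneg y
  linarith

lemma Q_le_expWeight_sq (y : ℝ) : Q y ≤ 2 * Real.sqrt 2 * expWeight y ^ 2 := by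
  rw [← exp_neg_abs_eq_expWeight_sq, Q, div_le_iff₀ (Real.cosh_pos y), ← Real.cosh_abs,
    Real.cosh_eq, Real.exp_neg]
  have := Real.exp_pos |y|
  have h0 : 0 < Real.sqrt 2 := by positivity
  field_simp
  nlinarith [sq_nonneg (Real.exp |y|)]

lemma isBigO_Q : Q =O[⊤] expWeight := by
  refine isBigO_iff.2 ⟨2 * Real.sqrt 2, Eventually.of_forall fun y => ?_⟩
  rw [Real.norm_of_nonneg (Q_pos y).le, Real.norm_of_nonneg (expWeight_pos y).le]
  refine (Q_le_expWeight_sq y).trans ?_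
  have := expWeight_pos y
  have := expWeight_le_one y
  gcongr
  nlinarith

lemma isBigO_Q_one : Q =O[⊤] (fun _ => (1 : ℝ)) := by
  refine isBigO_iff.2 ⟨Real.sqrt 2, Eventually.of_forall fun y => ?_⟩
  rw [Real.norm_of_nonneg (Q_pos y).le]
  simpa using Q_le_sqrt_two y

lemma isBigO_rQ_one : rQ =O[⊤] (fun _ => (1 : ℝ)) :=
  isBigO_iff.2 ⟨1, Eventually.of_forall fun y => by simpa using abs_rQ_le_one y⟩

lemma isBigO_id_mul_Q : (fun y => y * Q y) =O[⊤] expWeight := by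
  refine isBigO_iff.2 ⟨4 * Real.sqrt 2, Eventually.of_forall fun y => ?_⟩
  rw [norm_mul, Real.norm_of_nonneg (Q_pos y).le, Real.norm_of_nonneg (expWeight_pos y).le,
    Real.norm_eq_abs]
  have h1 : |y| * expWeight y ≤ 2 := by
    have h := Real.add_one_le_exp (|y| / 2)
    have h2 : expWeight y * Real.exp (|y| / 2) = 1 := by
      rw [expWeight, ← Real.exp_add]
      simp [neg_div]
    nlinarith [expWeight_pos y, abs_nonneg y]
  have := expWeight_pos y
  calc |y| * Q y ≤ |y| * (2 * Real.sqrt 2 * expWeight y ^ 2) := by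
        gcongr
        exact Q_le_expWeight_sq y
    _ = 2 * Real.sqrt 2 * expWeight y * (|y| * expWeight y) := by ring
    _ ≤ 2 * Real.sqrt 2 * expWeight y * 2 := by gcongr
    _ = _ := by ring

lemma isBigO_expWeight_one : expWeight =O[⊤] (fun _ => (1 : ℝ)) :=
  isBigO_iff.2 ⟨1, Eventually.of_forall fun y => by
    rw [Real.norm_of_nonneg (expWeight_pos y).le]; simpa using expWeight_le_one y⟩

lemma isBigO_id_mul_Q_one : (fun y => y * Q y) =O[⊤] (fun _ => (1 : ℝ)) :=
  isBigO_id_mul_Q.trans isBigO_expWeight_one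

lemma integrable_expWeight : Integrable expWeight := by
  have h : IntegrableOn (fun y : ℝ => Real.exp (-(1 / 2) * y)) (Set.Ioi 0) :=
    exp_neg_integrableOn_Ioi 0 (by norm_num)
  have h1 : IntegrableOn expWeight (Set.Ioi 0) := by
    refine h.congr_fun (fun y hy => ?_) measurableSet_Ioi
    simp only [expWeight, abs_of_pos (Set.mem_Ioi.1 hy)]
    congr 1
    ring
  have h2 : IntegrableOn expWeight (Set.Iic 0) := by
    refine (integrableOn_exp_mul_Iic (a := 1 / 2) (by norm_num) 0).congr_fun (fun y hy => ?_)
      measurableSet_Iic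
    simp only [expWeight, abs_of_nonpos (Set.mem_Iic.1 hy)]
    congr 1
    ring
  rw [← integrableOn_univ, ← Set.Iic_union_Ioi (a := (0 : ℝ))]
  exact h2.union h1

lemma tendsto_expWeight_atTop : Tendsto expWeight atTop (𝓝 0) := by
  refine Real.tendsto_exp_atBot.comp ?_
  simp_rw [neg_div]
  exact tendsto_neg_atTop_atBot.comp (tendsto_abs_atTop_atTop.atTop_div_const (by norm_num))

lemma tendsto_expWeight_atBot : Tendsto expWeight atBot (𝓝 0) := by
  refine Real.tendsto_exp_atBot.comp ?_
  simp_rw [neg_div]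
  exact tendsto_neg_atTop_atBot.comp (tendsto_abs_atBot_atTop.atTop_div_const (by norm_num))

lemma integrable_of_isBigO_expWeight {f : ℝ → ℝ} (hf : Continuous f) (h : f =O[⊤] expWeight) :
    Integrable f :=
  let ⟨C, hC⟩ := isBigO_top.1 h
  (integrable_expWeight.norm.const_mul C).mono' hf.aestronglyMeasurable
    (Eventually.of_forall fun y => by simpa using hC y)

/-- The integral of a derivative vanishes for exponentially decaying functions. -/
lemma integral_eq_zero_of_hasDerivAt {W w : ℝ → ℝ} (hd : ∀ y, HasDerivAt W (w y) y)
    (hW : W =O[⊤] expWeight) (hw : Integrable w) : ∫ y, w y = 0 := by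
  have h := integral_of_hasDerivAt_of_tendsto hd hw
    ((hW.mono le_top).trans_tendsto tendsto_expWeight_atBot)
    ((hW.mono le_top).trans_tendsto tendsto_expWeight_atTop)
  simpa using h

lemma isBigO_A_mul_Q : (fun y => A y * Q y) =O[⊤] (fun _ => (1 : ℝ)) := by
  have h : (fun y => A y * Q y) =
      fun y => 1 / 2 - 3 / 4 * (Q y * Q y + rQ y * (y * Q y) * Q y) := by
    ext y
    have := (Q_pos y).ne'
    rw [A_eq]
    field_simp
  rw [h]
  have h1 := isBigO_Q_one.mul isBigO_Q_one
  have h2 := (isBigO_rQ_one.mul isBigO_id_mul_Q_one).mul isBigO_Q_one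
  simp only [mul_one] at h1 h2
  exact (isBigO_const_const _ one_ne_zero _).sub ((h1.add h2).const_mul_left _)

lemma isBigO_dA_mul_Q : (fun y => dA y * Q y) =O[⊤] (fun _ => (1 : ℝ)) := by
  have h : (fun y => dA y * Q y) = fun y => -1 / 2 * rQ y
      - 3 / 4 * (2 * (rQ y * Q y * Q y) + (y * Q y) * (Q y - Q y * Q y * Q y)) := by
    ext y
    have := (Q_pos y).ne'
    rw [dA]
    field_simp
  rw [h]
  have h1 := (isBigO_rQ_one.mul isBigO_Q_one).mul isBigO_Q_one
  have h2 := (isBigO_Q_one.mul isBigO_Q_one).mul isBigO_Q_one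
  simp only [mul_one] at h1 h2
  have h3 := isBigO_id_mul_Q_one.mul (isBigO_Q_one.sub h2)
  simp only [mul_one] at h3
  exact (isBigO_rQ_one.const_mul_left _).sub (((h1.const_mul_left _).add h3).const_mul_left _)
lemma hasDerivAt_Q_rpow (m : ℝ) (y : ℝ) :
    HasDerivAt (fun y => Q y ^ m) (m * rQ y * Q y ^ m) y := by
  refine ((hasDerivAt_Q y).rpow_const (p := m) (Or.inl (Q_pos y).ne')).congr_deriv ?_
  rw [Real.rpow_sub_one (Q_pos y).ne']
  have := (Q_pos y).ne'
  field_simp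

lemma continuous_Q_rpow (m : ℝ) : Continuous fun y => Q y ^ m :=
  continuous_iff_continuousAt.2 fun y => (hasDerivAt_Q_rpow m y).continuousAt

lemma isBigO_Q_rpow {m : ℝ} (hm : 1 ≤ m) : (fun y => Q y ^ m) =O[⊤] Q := by
  refine isBigO_top.2 ⟨Real.sqrt 2 ^ (m - 1), fun y => ?_⟩
  have h := Q_pos y
  rw [Real.norm_of_nonneg (by positivity), Real.norm_of_nonneg h.le]
  have h1 : Q y ^ m = Q y ^ (m - 1) * Q y := by
    rw [Real.rpow_sub_one h.ne']
    field_simp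
  rw [h1]
  gcongr
  exact Q_le_sqrt_two y

/-- The power `Q ^ (2 * σ - 1)`. -/
noncomputable def Qpow (σ y : ℝ) : ℝ := Q y ^ (2 * σ - 1)

lemma hasDerivAt_Qpow (σ y : ℝ) : HasDerivAt (Qpow σ) ((2 * σ - 1) * rQ y * Qpow σ y) y :=
  hasDerivAt_Q_rpow _ y

lemma continuous_Qpow (σ : ℝ) : Continuous (Qpow σ) := continuous_Q_rpow _

lemma Qpow_pos (σ y : ℝ) : 0 < Qpow σ y := Real.rpow_pos_of_pos (Q_pos y) _

lemma isBigO_Qpow {σ : ℝ} (hσ : 1 ≤ σ) : Qpow σ =O[⊤] expWeight :=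
  (isBigO_Q_rpow (by linarith)).trans isBigO_Q

lemma Q_rpow_eq (σ y : ℝ) (n : ℕ) (m : ℝ) (h : m = 2 * σ - 1 + n) :
    Q y ^ m = Qpow σ y * Q y ^ n := by
  rw [h, Real.rpow_add_natCast (Q_pos y).ne', Qpow]

lemma Q_rpow_two_mul (σ y : ℝ) : Q y ^ (2 * σ) = Qpow σ y * Q y := by
  simpa using Q_rpow_eq σ y 1 (2 * σ) (by push_cast; ring)

/-- The primitive occurring in `D0`. -/
noncomputable def primA (σ y : ℝ) : ℝ := ∫ z in (0:ℝ)..y, A z * Q z ^ (2 * σ + 1)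

lemma continuous_A : Continuous A :=
  continuous_iff_continuousAt.2 fun y => (hasDerivAt_A y).continuousAt

lemma hasDerivAt_primA (σ y : ℝ) : HasDerivAt (primA σ) (A y * (Qpow σ y * Q y ^ 2)) y := by
  have hc : Continuous fun z => A z * Q z ^ (2 * σ + 1) := continuous_A.mul (continuous_Q_rpow _)
  refine (hc.integral_hasStrictDerivAt 0 y).hasDerivAt.congr_deriv ?_
  rw [Q_rpow_eq σ y 2 _ (by push_cast; ring)]

lemma isBigO_intervalIntegral {f : ℝ → ℝ} (hf : Integrable f) :
    (fun y => ∫ z in (0:ℝ)..y, f z) =O[⊤] (fun _ => (1 : ℝ)) := by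
  refine isBigO_top.2 ⟨∫ z, ‖f z‖, fun y => ?_⟩
  rw [norm_one, mul_one]
  refine intervalIntegral.norm_integral_le_integral_norm_uIoc.trans ?_
  exact setIntegral_le_integral hf.norm (Eventually.of_forall fun z => norm_nonneg _)

lemma isBigO_primA {σ : ℝ} (hσ : 1 ≤ σ) : primA σ =O[⊤] (fun _ => (1 : ℝ)) := by
  refine isBigO_intervalIntegral (integrable_of_isBigO_expWeight
    (continuous_A.mul (continuous_Q_rpow _)) ?_)
  have h := (isBigO_A_mul_Q.mul isBigO_Q_one).mul (isBigO_Qpow hσ)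
  simp only [one_mul] at h
  refine h.congr_left fun y => ?_
  rw [Q_rpow_eq σ y 2 _ (by push_cast; ring)]
  ring

lemma D0_eq (σ y : ℝ) : D0 σ y =
    -(rQ y * Q y) * primA σ y + A y * (Qpow σ y * Q y ^ 3) / (2 * σ + 2) := by
  rw [D0, deriv_Q, primA, Q_rpow_eq σ y 3 (2 * σ + 2) (by push_cast; ring)]

/-- The derivative of `D0`. -/
noncomputable def dD0 (σ y : ℝ) : ℝ :=
  -(Q y - Q y ^ 3) * primA σ y + dA y * (Qpow σ y * Q y ^ 3) / (2 * σ + 2)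

lemma hasDerivAt_Qpow_mul_Q_cube (σ y : ℝ) : HasDerivAt (fun y => Qpow σ y * Q y ^ 3)
    ((2 * σ + 2) * (rQ y * (Qpow σ y * Q y ^ 3))) y := by
  refine ((hasDerivAt_Qpow σ y).mul ((hasDerivAt_Q y).fun_pow 3)).congr_deriv ?_
  push_cast
  ring

lemma hasDerivAt_D0 {σ : ℝ} (hσ : 1 ≤ σ) (y : ℝ) : HasDerivAt (D0 σ) (dD0 σ y) y := by
  have hs : 2 * σ + 2 ≠ 0 := by linarith
  have h := ((hasDerivAt_rQ_mul_Q y).fun_neg.fun_mul (hasDerivAt_primA σ y)).fun_add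
    (((hasDerivAt_A y).fun_mul (hasDerivAt_Qpow_mul_Q_cube σ y)).div_const (2 * σ + 2))
  refine (h.congr_of_eventuallyEq (Eventually.of_forall fun z => D0_eq σ z)).congr_deriv ?_
  rw [dD0]
  field_simp
  ring

lemma hasDerivAt_dD0 {σ : ℝ} (hσ : 1 ≤ σ) (y : ℝ) :
    HasDerivAt (dD0 σ) (D0 σ y - 3 * Q y ^ 2 * D0 σ y - Qpow σ y * Q y ^ 2) y := by
  have hs : 2 * σ + 2 ≠ 0 := by linarith
  have h := (((hasDerivAt_Q y).fun_sub ((hasDerivAt_Q y).fun_pow 3)).fun_neg.fun_mul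
    (hasDerivAt_primA σ y)).fun_add
    (((hasDerivAt_dA y).fun_mul (hasDerivAt_Qpow_mul_Q_cube σ y)).div_const (2 * σ + 2))
  refine h.congr_deriv ?_
  rw [D0_eq]
  field_simp
  push_cast
  linear_combination (2 * σ + 2) * Qpow σ y * Q y ^ 2 * wronskian y

lemma isBigO_D0 {σ : ℝ} (hσ : 1 ≤ σ) : D0 σ =O[⊤] expWeight := by
  have h1 := (isBigO_rQ_one.mul isBigO_Q).mul (isBigO_primA hσ)
  have h2 := (isBigO_A_mul_Q.mul (isBigO_Q_one.mul isBigO_Q_one)).mul (isBigO_Qpow hσ)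
  simp only [one_mul, mul_one] at h1 h2
  refine (h1.neg_left.add (h2.const_mul_left (1 / (2 * σ + 2)))).congr_left fun y => ?_
  rw [D0_eq]
  ring

lemma isBigO_dD0 {σ : ℝ} (hσ : 1 ≤ σ) : dD0 σ =O[⊤] expWeight := by
  have h0 := (isBigO_Q_one.mul isBigO_Q_one).mul isBigO_Q
  simp only [one_mul] at h0
  have h1 := (isBigO_Q.sub h0).mul (isBigO_primA hσ)
  have h2 := (isBigO_dA_mul_Q.mul (isBigO_Q_one.mul isBigO_Q_one)).mul (isBigO_Qpow hσ)
  simp only [one_mul, mul_one] at h1 h2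
  refine (h1.neg_left.add (h2.const_mul_left (1 / (2 * σ + 2)))).congr_left fun y => ?_
  rw [dD0]
  ring

lemma hasDerivAt_integral_Iic {g : ℝ → ℝ} (hc : Continuous g)
    (hi : ∀ y, IntegrableOn g (Set.Iic y)) (y : ℝ) :
    HasDerivAt (fun y => ∫ z in Set.Iic y, g z) (g y) y := by
  have h := (hc.integral_hasStrictDerivAt 0 y).hasDerivAt.const_add (∫ z in Set.Iic 0, g z)
  refine h.congr_of_eventuallyEq (Eventually.of_forall fun x => ?_)
  simp only [← intervalIntegral.integral_Iic_sub_Iic (hi 0) (hi x)]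
  ring

lemma hasDerivAt_integral_Ioi {g : ℝ → ℝ} (hc : Continuous g)
    (hi : ∀ y, IntegrableOn g (Set.Ioi y)) (y : ℝ) :
    HasDerivAt (fun y => ∫ z in Set.Ioi y, g z) (-g y) y := by
  have h := (hc.integral_hasStrictDerivAt 0 y).hasDerivAt.const_sub (∫ z in Set.Ioi 0, g z)
  refine h.congr_of_eventuallyEq (Eventually.of_forall fun x => ?_)
  simp only [← intervalIntegral.integral_interval_add_Ioi' (hc.intervalIntegrable 0 x) (hi x)]
  ring

section Convolution

variable {q : ℝ → ℝ}

lemma integrableOn_exp_mul_Iic_of_integrable {c : ℝ} (hc : 0 ≤ c) (hq : Continuous q)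
    (hi : Integrable q) (y : ℝ) : IntegrableOn (fun z => Real.exp (c * z) * q z) (Set.Iic y) := by
  refine Integrable.mono' (hi.norm.const_mul (Real.exp (c * y))).integrableOn
    (by fun_prop) ((ae_restrict_iff' measurableSet_Iic).2 (Eventually.of_forall fun z hz => ?_))
  rw [norm_mul, Real.norm_of_nonneg (Real.exp_pos _).le]
  gcongr
  exact hz

lemma integrableOn_exp_mul_Ioi_of_integrable {c : ℝ} (hc : 0 ≤ c) (hq : Continuous q)
    (hi : Integrable q) (y : ℝ) : IntegrableOn (fun z => Real.exp (-c * z) * q z) (Set.Ioi y) := by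
  refine Integrable.mono' (hi.norm.const_mul (Real.exp (-c * y))).integrableOn
    (by fun_prop) ((ae_restrict_iff' measurableSet_Ioi).2 (Eventually.of_forall fun z hz => ?_))
  rw [norm_mul, Real.norm_of_nonneg (Real.exp_pos _).le]
  have : c * y ≤ c * z := mul_le_mul_of_nonneg_left (le_of_lt hz) hc
  gcongr ?_ * _
  exact Real.exp_le_exp.2 (by linarith)

/-- The derivative of the convolution with `exp (-c * |y|)`. -/
noncomputable def dexpConv (c : ℝ) (q : ℝ → ℝ) (y : ℝ) : ℝ :=
  c * (Real.exp (c * y) * (∫ z in Set.Ioi y, Real.exp (-c * z) * q z)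
    - Real.exp (-c * y) * ∫ z in Set.Iic y, Real.exp (c * z) * q z)

lemma integrable_exp_neg_mul_abs_sub_mul {c : ℝ} (hc : 0 ≤ c) (hq : Continuous q)
    (hi : Integrable q) (y : ℝ) : Integrable (fun z => Real.exp (-c * |y - z|) * q z) := by
  refine Integrable.mono' hi.norm (by fun_prop) (Eventually.of_forall fun z => ?_)
  rw [norm_mul, Real.norm_of_nonneg (Real.exp_pos _).le]
  have : Real.exp (-c * |y - z|) ≤ 1 := Real.exp_le_one_iff.2 (by
    have := mul_nonneg hc (abs_nonneg (y - z))
    linarith)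
  nlinarith [norm_nonneg (q z)]

lemma expConv_eq {c : ℝ} (hc : 0 ≤ c) (hq : Continuous q) (hi : Integrable q) (y : ℝ) :
    ∫ z, Real.exp (-c * |y - z|) * q z =
      Real.exp (c * y) * (∫ z in Set.Ioi y, Real.exp (-c * z) * q z)
        + Real.exp (-c * y) * ∫ z in Set.Iic y, Real.exp (c * z) * q z := by
  have h := integrable_exp_neg_mul_abs_sub_mul hc hq hi y
  rw [← intervalIntegral.integral_Iic_add_Ioi (b := y) h.integrableOn h.integrableOn, add_comm,
    ← integral_const_mul, ← integral_const_mul]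
  congr 1
  · refine setIntegral_congr_fun measurableSet_Ioi fun z hz => ?_
    have hz' : y < z := hz
    simp only [abs_of_neg (sub_neg.2 hz')]
    rw [← mul_assoc, ← Real.exp_add]
    ring_nf
  · refine setIntegral_congr_fun measurableSet_Iic fun z hz => ?_
    have hz' : z ≤ y := hz
    simp only [abs_of_nonneg (sub_nonneg.2 hz')]
    rw [← mul_assoc, ← Real.exp_add]
    ring_nf

lemma hasDerivAt_exp_const_mul (c y : ℝ) :
    HasDerivAt (fun y => Real.exp (c * y)) (c * Real.exp (c * y)) y := by
  simpa [mul_comm] using ((hasDerivAt_id y).const_mul c).exp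

lemma hasDerivAt_exp_mul_integral_Ioi {c : ℝ} (hc : 0 ≤ c) (hq : Continuous q) (hi : Integrable q)
    (y : ℝ) : HasDerivAt
      (fun y => Real.exp (c * y) * ∫ z in Set.Ioi y, Real.exp (-c * z) * q z)
      (c * (Real.exp (c * y) * ∫ z in Set.Ioi y, Real.exp (-c * z) * q z) - q y) y := by
  refine ((hasDerivAt_exp_const_mul c y).fun_mul (hasDerivAt_integral_Ioi (by fun_prop)
    (integrableOn_exp_mul_Ioi_of_integrable hc hq hi) y)).congr_deriv ?_
  have : Real.exp (c * y) * Real.exp (-c * y) = 1 := by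
    rw [← Real.exp_add]
    simp
  linear_combination -q y * this

lemma hasDerivAt_exp_mul_integral_Iic {c : ℝ} (hc : 0 ≤ c) (hq : Continuous q) (hi : Integrable q)
    (y : ℝ) : HasDerivAt
      (fun y => Real.exp (-c * y) * ∫ z in Set.Iic y, Real.exp (c * z) * q z)
      (-c * (Real.exp (-c * y) * ∫ z in Set.Iic y, Real.exp (c * z) * q z) + q y) y := by
  refine ((hasDerivAt_exp_const_mul (-c) y).fun_mul (hasDerivAt_integral_Iic (by fun_prop)
    (integrableOn_exp_mul_Iic_of_integrable hc hq hi) y)).congr_deriv ?_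
  have : Real.exp (c * y) * Real.exp (-c * y) = 1 := by
    rw [← Real.exp_add]
    simp
  linear_combination q y * this

lemma hasDerivAt_expConv {c : ℝ} (hc : 0 ≤ c) (hq : Continuous q) (hi : Integrable q) (y : ℝ) :
    HasDerivAt (fun y => ∫ z, Real.exp (-c * |y - z|) * q z) (dexpConv c q y) y := by
  have h := (hasDerivAt_exp_mul_integral_Ioi hc hq hi y).fun_add
    (hasDerivAt_exp_mul_integral_Iic hc hq hi y)
  refine (h.congr_of_eventuallyEq
    (Eventually.of_forall fun x => expConv_eq hc hq hi x)).congr_deriv ?_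
  rw [dexpConv]
  ring

lemma hasDerivAt_dexpConv {c : ℝ} (hc : 0 ≤ c) (hq : Continuous q) (hi : Integrable q) (y : ℝ) :
    HasDerivAt (dexpConv c q)
      (c ^ 2 * (∫ z, Real.exp (-c * |y - z|) * q z) - 2 * c * q y) y := by
  have h := ((hasDerivAt_exp_mul_integral_Ioi hc hq hi y).fun_sub
    (hasDerivAt_exp_mul_integral_Iic hc hq hi y)).const_mul c
  refine h.congr_deriv ?_
  rw [expConv_eq hc hq hi]
  ring

lemma isBigO_expConv {c : ℝ} (hc : 0 ≤ c) (hi : Integrable q) :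
    (fun y => ∫ z, Real.exp (-c * |y - z|) * q z) =O[⊤] (fun _ => (1 : ℝ)) := by
  refine isBigO_top.2 ⟨∫ z, ‖q z‖, fun y => ?_⟩
  rw [norm_one, mul_one]
  refine norm_integral_le_of_norm_le hi.norm (Eventually.of_forall fun z => ?_)
  rw [norm_mul, Real.norm_of_nonneg (Real.exp_pos _).le]
  have : Real.exp (-c * |y - z|) ≤ 1 := Real.exp_le_one_iff.2 (by
    have := mul_nonneg hc (abs_nonneg (y - z))
    linarith)
  nlinarith [norm_nonneg (q z)]

lemma isBigO_dexpConv {c : ℝ} (hc : 0 ≤ c) (hq : Continuous q) (hi : Integrable q)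
    (hpos : ∀ z, 0 ≤ q z) : dexpConv c q =O[⊤] (fun _ => (1 : ℝ)) := by
  refine IsBigO.trans (isBigO_top.2 ⟨c, fun y => ?_⟩) (isBigO_expConv hc hi)
  rw [dexpConv, expConv_eq hc hq hi, norm_mul, Real.norm_of_nonneg hc]
  have h1 : 0 ≤ Real.exp (c * y) * ∫ z in Set.Ioi y, Real.exp (-c * z) * q z :=
    mul_nonneg (Real.exp_pos _).le
      (integral_nonneg fun z => mul_nonneg (Real.exp_pos _).le (hpos z))
  have h2 : 0 ≤ Real.exp (-c * y) * ∫ z in Set.Iic y, Real.exp (c * z) * q z :=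
    mul_nonneg (Real.exp_pos _).le
      (integral_nonneg fun z => mul_nonneg (Real.exp_pos _).le (hpos z))
  gcongr
  rw [Real.norm_eq_abs, Real.norm_eq_abs, abs_of_nonneg (add_nonneg h1 h2), abs_le]
  constructor <;> linarith

/-- The derivative of the convolution with `|y|`. -/
noncomputable def dabsConv (q : ℝ → ℝ) (y : ℝ) : ℝ :=
  (∫ z in Set.Iic y, q z) - ∫ z in Set.Ioi y, q z

lemma absConv_eq (hi : Integrable q) (hi1 : Integrable fun z => z * q z) (y : ℝ) :
    ∫ z, |y - z| * q z = (y * (∫ z in Set.Iic y, q z) - ∫ z in Set.Iic y, z * q z)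
      + ((∫ z in Set.Ioi y, z * q z) - y * ∫ z in Set.Ioi y, q z) := by
  have h1 : IntegrableOn (fun z => |y - z| * q z) (Set.Iic y) :=
    ((hi.const_mul y).sub hi1).integrableOn.congr_fun (fun z hz => by
      have hz' : z ≤ y := hz
      simp only [Pi.sub_apply, abs_of_nonneg (sub_nonneg.2 hz')]
      ring) measurableSet_Iic
  have h2 : IntegrableOn (fun z => |y - z| * q z) (Set.Ioi y) :=
    (hi1.sub (hi.const_mul y)).integrableOn.congr_fun (fun z hz => by
      have hz' : y < z := hz
      simp only [Pi.sub_apply, abs_of_neg (sub_neg.2 hz')]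
      ring) measurableSet_Ioi
  rw [← intervalIntegral.integral_Iic_add_Ioi h1 h2, ← integral_const_mul, ← integral_const_mul,
    ← integral_sub (hi.const_mul y).integrableOn hi1.integrableOn,
    ← integral_sub hi1.integrableOn (hi.const_mul y).integrableOn]
  congr 1
  · refine setIntegral_congr_fun measurableSet_Iic fun z hz => ?_
    have hz' : z ≤ y := hz
    simp only [abs_of_nonneg (sub_nonneg.2 hz')]
    ring
  · refine setIntegral_congr_fun measurableSet_Ioi fun z hz => ?_
    have hz' : y < z := hz
    simp only [abs_of_neg (sub_neg.2 hz')]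
    ring

lemma hasDerivAt_absConv (hq : Continuous q) (hi : Integrable q)
    (hi1 : Integrable fun z => z * q z) (y : ℝ) :
    HasDerivAt (fun y => ∫ z, |y - z| * q z) (dabsConv q y) y := by
  have h := (((hasDerivAt_id y).fun_mul
    (hasDerivAt_integral_Iic hq (fun _ => hi.integrableOn) y)).fun_sub
    (hasDerivAt_integral_Iic (by fun_prop) (fun _ => hi1.integrableOn) y)).fun_add
    ((hasDerivAt_integral_Ioi (by fun_prop) (fun _ => hi1.integrableOn) y).fun_sub
    ((hasDerivAt_id y).fun_mul (hasDerivAt_integral_Ioi hq (fun _ => hi.integrableOn) y)))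
  refine (h.congr_of_eventuallyEq
    (Eventually.of_forall fun x => absConv_eq hi hi1 x)).congr_deriv ?_
  simp only [dabsConv, id]
  ring

lemma hasDerivAt_dabsConv (hq : Continuous q) (hi : Integrable q) (y : ℝ) :
    HasDerivAt (dabsConv q) (2 * q y) y := by
  refine ((hasDerivAt_integral_Iic hq (fun _ => hi.integrableOn) y).fun_sub
    (hasDerivAt_integral_Ioi hq (fun _ => hi.integrableOn) y)).congr_deriv ?_
  ring

lemma isBigO_dabsConv (hi : Integrable q) : dabsConv q =O[⊤] (fun _ => (1 : ℝ)) := by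
  have h : ∀ s : Set ℝ, ‖∫ z in s, q z‖ ≤ ∫ z, ‖q z‖ := fun s =>
    (norm_integral_le_integral_norm _).trans
      (setIntegral_le_integral hi.norm (Eventually.of_forall fun z => norm_nonneg _))
  exact (isBigO_top.2 ⟨∫ z, ‖q z‖, fun y => by simpa using h _⟩).sub
    (isBigO_top.2 ⟨∫ z, ‖q z‖, fun y => by simpa using h _⟩)

lemma isBigO_absConv (hi : Integrable q) (hi1 : Integrable fun z => z * q z) :
    (fun y => ∫ z, |y - z| * q z) =O[⊤] (fun y => 1 + |y|) := by
  refine isBigO_top.2 ⟨(∫ z, ‖q z‖) + ∫ z, ‖z * q z‖, fun y => ?_⟩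
  have hq0 : 0 ≤ ∫ z, ‖q z‖ := integral_nonneg fun z => norm_nonneg _
  have hq1 : 0 ≤ ∫ z, ‖z * q z‖ := integral_nonneg fun z => norm_nonneg _
  rw [Real.norm_of_nonneg (by positivity : 0 ≤ 1 + |y|)]
  calc ‖∫ z, |y - z| * q z‖ ≤ ∫ z, (|y| * ‖q z‖ + ‖z * q z‖) := by
        refine norm_integral_le_of_norm_le ((hi.norm.const_mul _).add hi1.norm)
          (Eventually.of_forall fun z => ?_)
        rw [norm_mul, norm_mul, Real.norm_eq_abs |y - z|, abs_abs, ← add_mul, Real.norm_eq_abs z]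
        gcongr
        exact abs_sub _ _
    _ = |y| * (∫ z, ‖q z‖) + ∫ z, ‖z * q z‖ := by
        rw [integral_add (hi.norm.const_mul _) hi1.norm, integral_const_mul]
    _ ≤ _ := by nlinarith [abs_nonneg y]

end Convolution

lemma integrable_Q_rpow {σ : ℝ} (hσ : 1 ≤ σ) : Integrable fun z => Q z ^ (2 * σ) :=
  integrable_of_isBigO_expWeight (continuous_Q_rpow _)
    ((isBigO_Q_rpow (by linarith)).trans isBigO_Q)

lemma integrable_id_mul_Q_rpow {σ : ℝ} (hσ : 1 ≤ σ) : Integrable fun z => z * Q z ^ (2 * σ) := by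
  refine integrable_of_isBigO_expWeight (continuous_id.mul (continuous_Q_rpow _)) ?_
  exact ((isBigO_refl (fun z : ℝ => z) ⊤).mul (isBigO_Q_rpow (by linarith))).trans isBigO_id_mul_Q

/-- The derivative of `T1`. -/
noncomputable def dT1 (σ y : ℝ) : ℝ :=
  -((σ - 1) ^ 2 / (2 * (σ + 1))) * dabsConv (fun z => Q z ^ (2 * σ)) y

/-- The derivative of `T2`. -/
noncomputable def dT2 (σ y : ℝ) : ℝ :=
  -(Real.sqrt 2 * σ * (σ - 1) / (4 * (σ + 1))) *
    dexpConv (Real.sqrt 2) (fun z => Q z ^ (2 * σ)) y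

lemma hasDerivAt_T1 {σ : ℝ} (hσ : 1 ≤ σ) (y : ℝ) : HasDerivAt (T1 σ) (dT1 σ y) y :=
  (hasDerivAt_absConv (continuous_Q_rpow _) (integrable_Q_rpow hσ)
    (integrable_id_mul_Q_rpow hσ) y).const_mul _

lemma hasDerivAt_dT1 {σ : ℝ} (hσ : 1 ≤ σ) (y : ℝ) :
    HasDerivAt (dT1 σ) (0 * T1 σ y + -((σ - 1) ^ 2 / (σ + 1)) * (Qpow σ y * Q y)) y := by
  refine ((hasDerivAt_dabsConv (continuous_Q_rpow _) (integrable_Q_rpow hσ) y).const_mul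
    _).congr_deriv ?_
  have : σ + 1 ≠ 0 := by linarith
  rw [Q_rpow_two_mul]
  field_simp
  ring

lemma hasDerivAt_T2 {σ : ℝ} (hσ : 1 ≤ σ) (y : ℝ) : HasDerivAt (T2 σ) (dT2 σ y) y :=
  (hasDerivAt_expConv (Real.sqrt_nonneg 2) (continuous_Q_rpow _)
    (integrable_Q_rpow hσ) y).const_mul _

lemma hasDerivAt_dT2 {σ : ℝ} (hσ : 1 ≤ σ) (y : ℝ) :
    HasDerivAt (dT2 σ) (2 * T2 σ y + σ * (σ - 1) / (σ + 1) * (Qpow σ y * Q y)) y := by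
  refine ((hasDerivAt_dexpConv (Real.sqrt_nonneg 2) (continuous_Q_rpow _)
    (integrable_Q_rpow hσ) y).const_mul _).congr_deriv ?_
  have : σ + 1 ≠ 0 := by linarith
  have h2 : Real.sqrt 2 ^ 2 = 2 := Real.sq_sqrt (by norm_num)
  rw [Q_rpow_two_mul, h2, T2]
  field_simp
  linear_combination 2 * (σ - 1) * Qpow σ y * Q y * h2

lemma isBigO_Q_mul_of_one {f : ℝ → ℝ} (hf : f =O[⊤] (fun _ => (1 : ℝ))) :
    (fun y => Q y * f y) =O[⊤] expWeight := by
  simpa using isBigO_Q.mul hf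

lemma isBigO_Q_mul_T1 {σ : ℝ} (hσ : 1 ≤ σ) : (fun y => Q y * T1 σ y) =O[⊤] expWeight := by
  have h1 : (fun y => Q y * (1 + |y|)) =O[⊤] expWeight := by
    refine (isBigO_Q.add (isBigO_id_mul_Q.norm_left)).congr_left fun y => ?_
    rw [norm_mul, Real.norm_of_nonneg (Q_pos y).le, Real.norm_eq_abs]
    ring
  refine IsBigO.trans ?_ h1
  exact (isBigO_refl Q ⊤).mul ((isBigO_absConv (integrable_Q_rpow hσ)
    (integrable_id_mul_Q_rpow hσ)).const_mul_left _)

lemma isBigO_Q_mul_dT1 {σ : ℝ} (hσ : 1 ≤ σ) : (fun y => Q y * dT1 σ y) =O[⊤] expWeight :=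
  isBigO_Q_mul_of_one ((isBigO_dabsConv (integrable_Q_rpow hσ)).const_mul_left _)

lemma isBigO_Q_mul_T2 {σ : ℝ} (hσ : 1 ≤ σ) : (fun y => Q y * T2 σ y) =O[⊤] expWeight :=
  isBigO_Q_mul_of_one ((isBigO_expConv (Real.sqrt_nonneg 2)
    (integrable_Q_rpow hσ)).const_mul_left _)

lemma isBigO_Q_mul_dT2 {σ : ℝ} (hσ : 1 ≤ σ) : (fun y => Q y * dT2 σ y) =O[⊤] expWeight :=
  isBigO_Q_mul_of_one ((isBigO_dexpConv (Real.sqrt_nonneg 2) (continuous_Q_rpow _)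
    (integrable_Q_rpow hσ) (fun y => (Real.rpow_nonneg (Q_pos y).le _))).const_mul_left _)

/-- Integrable functions with vanishing integral. -/
def HasZeroIntegral (w : ℝ → ℝ) : Prop := Integrable w ∧ ∫ y, w y = 0

lemma HasZeroIntegral.add {v w : ℝ → ℝ} (hv : HasZeroIntegral v) (hw : HasZeroIntegral w) :
    HasZeroIntegral fun y => v y + w y :=
  ⟨hv.1.add hw.1, by rw [integral_add hv.1 hw.1, hv.2, hw.2, add_zero]⟩

lemma hasZeroIntegral_of_hasDerivAt {W w : ℝ → ℝ} (hd : ∀ y, HasDerivAt W (w y) y)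
    (hc : Continuous w) (hW : W =O[⊤] expWeight) (hw : w =O[⊤] expWeight) :
    HasZeroIntegral w :=
  have hi := integrable_of_isBigO_expWeight hc hw
  ⟨hi, integral_eq_zero_of_hasDerivAt hd hW hi⟩

/-- Green identity: if `u` solves a second order equation with potential `V` and source `g`, and `h`
solves the adjoint equation with right-hand side `a - db`, then `a u + b du - h g` is an exact
derivative. -/
lemma hasZeroIntegral_green {u du V g a b db h dh ddh ρ : ℝ → ℝ}
    (hu : ∀ y, HasDerivAt u (du y) y) (hdu : ∀ y, HasDerivAt du (V y * u y + g y) y)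
    (hb : ∀ y, HasDerivAt b (db y) y) (hh : ∀ y, HasDerivAt h (dh y) y)
    (hdh : ∀ y, HasDerivAt dh (ddh y) y) (ha : ∀ y, a y = db y + ddh y - V y * h y)
    (hac : Continuous a) (hgc : Continuous g)
    (haO : a =O[⊤] ρ) (hbO : b =O[⊤] ρ) (hhO : h =O[⊤] ρ) (hdhO : dh =O[⊤] ρ)
    (huO : (fun y => ρ y * u y) =O[⊤] expWeight) (hduO : (fun y => ρ y * du y) =O[⊤] expWeight)
    (hgO : (fun y => ρ y * g y) =O[⊤] expWeight) :
    HasZeroIntegral fun y => a y * u y + b y * du y - h y * g y := by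
  have cont {f df : ℝ → ℝ} (hf : ∀ y, HasDerivAt f (df y) y) : Continuous f :=
    continuous_iff_continuousAt.2 fun y => (hf y).continuousAt
  have mulO {f v : ℝ → ℝ} (hf : f =O[⊤] ρ) (hv : (fun y => ρ y * v y) =O[⊤] expWeight) :
      (fun y => f y * v y) =O[⊤] expWeight := (hf.mul (isBigO_refl v ⊤)).trans hv
  refine hasZeroIntegral_of_hasDerivAt (W := fun y => b y * u y + dh y * u y - h y * du y)
    (fun y => ?_) ?_ ?_ ?_
  · refine ((((hb y).fun_mul (hu y)).fun_add ((hdh y).fun_mul (hu y))).fun_sub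
      ((hh y).fun_mul (hdu y))).congr_deriv ?_
    rw [ha]
    ring
  · exact ((hac.mul (cont hu)).add ((cont hb).mul (cont hdu))).sub ((cont hh).mul hgc)
  · exact ((mulO hbO huO).add (mulO hdhO huO)).sub (mulO hhO hduO)
  · exact ((mulO haO huO).add (mulO hbO hduO)).sub (mulO hhO hgO)

/-- The primitive of `Q y * cos y`. -/
noncomputable def primCos (y : ℝ) : ℝ := ∫ z in (0:ℝ)..y, Q z * Real.cos z

lemma isBigO_cos_one : Real.cos =O[⊤] (fun _ => (1 : ℝ)) :=
  isBigO_iff.2 ⟨1, Eventually.of_forall fun y => by simpa using Real.abs_cos_le_one y⟩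

lemma hasDerivAt_primCos (y : ℝ) : HasDerivAt primCos (Q y * Real.cos y) y :=
  ((continuous_Q.mul Real.continuous_cos).integral_hasStrictDerivAt 0 y).hasDerivAt

lemma continuous_primCos : Continuous primCos :=
  continuous_iff_continuousAt.2 fun y => (hasDerivAt_primCos y).continuousAt

lemma isBigO_primCos : primCos =O[⊤] (fun _ => (1 : ℝ)) :=
  isBigO_intervalIntegral (integrable_of_isBigO_expWeight
    (continuous_Q.mul Real.continuous_cos) (isBigO_Q_mul_of_one isBigO_cos_one))

/-- Continuous functions of bounded quantities are bounded. -/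
lemma isBigO_comp_one {F : ℝ × ℝ × ℝ × ℝ × ℝ → ℝ} (hF : Continuous F) :
    (fun y => F (Q y, rQ y, Real.cos y, Real.sin y, primCos y)) =O[⊤] (fun _ => (1 : ℝ)) := by
  obtain ⟨C, hC⟩ := isBigO_top.1 isBigO_primCos
  have hK : IsCompact (Set.Icc (0 : ℝ) (Real.sqrt 2) ×ˢ Set.Icc (-1 : ℝ) 1 ×ˢ
      Set.Icc (-1 : ℝ) 1 ×ˢ Set.Icc (-1 : ℝ) 1 ×ˢ Set.Icc (-C) C) :=
    isCompact_Icc.prod (isCompact_Icc.prod (isCompact_Icc.prod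
      (isCompact_Icc.prod isCompact_Icc)))
  obtain ⟨M, hM⟩ := hK.exists_bound_of_continuousOn hF.continuousOn
  refine isBigO_top.2 ⟨M, fun y => ?_⟩
  rw [norm_one, mul_one]
  refine hM _ ⟨⟨(Q_pos y).le, Q_le_sqrt_two y⟩, abs_le.1 (abs_rQ_le_one y),
    abs_le.1 (Real.abs_cos_le_one y), abs_le.1 (Real.abs_sin_le_one y), abs_le.1 ?_⟩
  simpa using hC y

lemma isBigO_Q_mul_comp {F : ℝ × ℝ × ℝ × ℝ × ℝ → ℝ} (hF : Continuous F) :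
    (fun y => Q y * F (Q y, rQ y, Real.cos y, Real.sin y, primCos y)) =O[⊤] Q := by
  simpa using (isBigO_refl Q ⊤).mul (isBigO_comp_one hF)

attribute [fun_prop] continuous_Q continuous_rQ continuous_primCos continuous_Qpow

/-- The integrand collecting the terms of `Gamma0` that involve `D0`. -/
lemma hasZeroIntegral_D0 {σ : ℝ} (hσ : 1 ≤ σ) : HasZeroIntegral fun y =>
    (Q y ^ 4 * (13 * Q y ^ 2 - 16) * Real.cos y
      + 2 * rQ y * (2 - 30 * Q y ^ 2 + 29 * Q y ^ 4 - 8 * Q y ^ 6) * Real.sin y) * D0 σ y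
    + (-16 * Q y ^ 4 * (1 - Q y ^ 2 / 2) * Real.sin y
      - 8 * Q y ^ 4 * rQ y * Real.cos y) * dD0 σ y
    - ((25 / 3 * Q y ^ 2 - 5 / 3 * Q y ^ 4) * Real.cos y
      + rQ y * (-2 - 26 / 3 * Q y ^ 2 + 16 / 3 * Q y ^ 4) * Real.sin y
      + 16 / 3 * (rQ y * Q y) * primCos y) * (-(Qpow σ y * Q y ^ 2)) := by
  refine hasZeroIntegral_green (V := fun y => 1 - 3 * Q y ^ 2) (ρ := fun _ => 1)
    (db := fun y => (-56 * Q y ^ 4 + 48 * Q y ^ 6) * rQ y * Real.sin y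
      + (-48 * Q y ^ 4 + 28 * Q y ^ 6) * Real.cos y)
    (dh := fun y => (-2 + 40 / 3 * Q y ^ 2 - 4 / 3 * Q y ^ 4) * rQ y * Real.cos y
      + (-74 / 3 * Q y ^ 2 + 36 * Q y ^ 4 - 40 / 3 * Q y ^ 6) * Real.sin y
      + 16 / 3 * (Q y - Q y ^ 3) * primCos y)
    (ddh := fun y => (25 / 3 * Q y ^ 2 + 16 / 3 * Q y ^ 4 - 10 * Q y ^ 6) * Real.cos y
      + (2 - 188 / 3 * Q y ^ 2 + 436 / 3 * Q y ^ 4 - 80 * Q y ^ 6) * rQ y * Real.sin y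
      + (16 / 3 * Q y - 16 * Q y ^ 3) * rQ y * primCos y)
    (hasDerivAt_D0 hσ) (fun y => (hasDerivAt_dD0 hσ y).congr_deriv (by ring))
    (fun y => ?_) (fun y => ?_) (fun y => ?_) (fun y => ?_) (by fun_prop) (by fun_prop)
    ?_ ?_ ?_ ?_ ?_ ?_ ?_
  · have hQ := hasDerivAt_Q y
    have hr := hasDerivAt_rQ y
    have hc := Real.hasDerivAt_cos y
    have hs := Real.hasDerivAt_sin y
    refine (((((hQ.fun_pow 4).const_mul (-16)).fun_mul
      (((hQ.fun_pow 2).div_const 2).const_sub 1)).fun_mul hs).fun_sub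
      ((((hQ.fun_pow 4).const_mul 8).fun_mul hr).fun_mul hc)).congr_deriv ?_
    clear hQ hr hc hs
    have h := rQ_sq y
    push_cast
    grind
  · have hQ := hasDerivAt_Q y
    have hr := hasDerivAt_rQ y
    have hc := Real.hasDerivAt_cos y
    have hs := Real.hasDerivAt_sin y
    refine ((((((hQ.fun_pow 2).const_mul (25 / 3)).fun_sub
      ((hQ.fun_pow 4).const_mul (5 / 3))).fun_mul hc).fun_add
      ((hr.fun_mul ((((hQ.fun_pow 2).const_mul (26 / 3)).const_sub (-2)).fun_add
        ((hQ.fun_pow 4).const_mul (16 / 3)))).fun_mul hs)).fun_add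
      (((hr.fun_mul hQ).const_mul (16 / 3)).fun_mul (hasDerivAt_primCos y))).congr_deriv ?_
    clear hQ hr hc hs
    have h := rQ_sq y
    push_cast
    grind
  · have hQ := hasDerivAt_Q y
    have hr := hasDerivAt_rQ y
    have hc := Real.hasDerivAt_cos y
    have hs := Real.hasDerivAt_sin y
    refine ((((((((hQ.fun_pow 2).const_mul (40 / 3)).const_add (-2)).fun_sub
      ((hQ.fun_pow 4).const_mul (4 / 3))).fun_mul hr).fun_mul hc).fun_add
      (((((hQ.fun_pow 2).const_mul (-74 / 3)).fun_add ((hQ.fun_pow 4).const_mul 36)).fun_sub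
        ((hQ.fun_pow 6).const_mul (40 / 3))).fun_mul hs)).fun_add
      (((hQ.fun_sub (hQ.fun_pow 3)).const_mul (16 / 3)).fun_mul
        (hasDerivAt_primCos y))).congr_deriv ?_
    clear hQ hr hc hs
    have h := rQ_sq y
    push_cast
    grind
  · ring
  · exact isBigO_comp_one (F := fun p => p.1 ^ 4 * (13 * p.1 ^ 2 - 16) * p.2.2.1
      + 2 * p.2.1 * (2 - 30 * p.1 ^ 2 + 29 * p.1 ^ 4 - 8 * p.1 ^ 6) * p.2.2.2.1) (by fun_prop)
  · exact isBigO_comp_one (F := fun p => -16 * p.1 ^ 4 * (1 - p.1 ^ 2 / 2) * p.2.2.2.1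
      - 8 * p.1 ^ 4 * p.2.1 * p.2.2.1) (by fun_prop)
  · exact isBigO_comp_one (F := fun p => (25 / 3 * p.1 ^ 2 - 5 / 3 * p.1 ^ 4) * p.2.2.1
      + p.2.1 * (-2 - 26 / 3 * p.1 ^ 2 + 16 / 3 * p.1 ^ 4) * p.2.2.2.1
      + 16 / 3 * (p.2.1 * p.1) * p.2.2.2.2) (by fun_prop)
  · exact isBigO_comp_one (F := fun p => (-2 + 40 / 3 * p.1 ^ 2 - 4 / 3 * p.1 ^ 4) * p.2.1
        * p.2.2.1
      + (-74 / 3 * p.1 ^ 2 + 36 * p.1 ^ 4 - 40 / 3 * p.1 ^ 6) * p.2.2.2.1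
      + 16 / 3 * (p.1 - p.1 ^ 3) * p.2.2.2.2) (by fun_prop)
  · simpa using isBigO_D0 hσ
  · simpa using isBigO_dD0 hσ
  · have h := ((isBigO_Qpow hσ).mul isBigO_Q_one).mul isBigO_Q_one
    simp only [mul_one] at h
    exact h.neg_left.congr_left fun y => by ring

/-- The integrand collecting the terms of `Gamma0` that involve `T1`. -/
lemma hasZeroIntegral_T1 {σ : ℝ} (hσ : 1 ≤ σ) : HasZeroIntegral fun y =>
    (Q y * (2 * Q y ^ 2 * (3 * (1 - Q y ^ 2) ^ 2 - 1) * Real.cos y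
      + 4 * rQ y * (2 - Q y ^ 2) * (2 - 3 * Q y ^ 2) * Real.sin y)) * T1 σ y
    + (Q y * ((8 * Q y ^ 2 - 12 * Q y ^ 4) * rQ y * Real.cos y
      + 32 * (1 - Q y ^ 2) * (1 - Q y ^ 2 / 2) * Real.sin y)) * dT1 σ y
    - (Q y * ((8 - 4 * Q y ^ 2 + 2 * Q y ^ 4) * Real.cos y
      + rQ y * (-16 + 6 * Q y ^ 2) * Real.sin y)) *
      (-((σ - 1) ^ 2 / (σ + 1)) * (Qpow σ y * Q y)) := by
  refine hasZeroIntegral_green (V := fun _ => 0) (ρ := Q)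
    (db := fun y => Q y * ((32 - 24 * Q y ^ 2 - 60 * Q y ^ 4 + 36 * Q y ^ 6) * Real.cos y
      + (32 - 152 * Q y ^ 2 + 92 * Q y ^ 4) * rQ y * Real.sin y))
    (dh := fun y => Q y * ((-8 - 6 * Q y ^ 2 + 10 * Q y ^ 4) * rQ y * Real.cos y
      + (-24 + 38 * Q y ^ 2 - 14 * Q y ^ 4) * Real.sin y))
    (ddh := fun y => Q y * ((-32 + 28 * Q y ^ 2 + 48 * Q y ^ 4 - 30 * Q y ^ 6) * Real.cos y
      + (-16 + 120 * Q y ^ 2 - 80 * Q y ^ 4) * rQ y * Real.sin y))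
    (hasDerivAt_T1 hσ) (hasDerivAt_dT1 hσ)
    (fun y => ?_) (fun y => ?_) (fun y => ?_) (fun y => ?_) (by fun_prop) (by fun_prop)
    ?_ ?_ ?_ ?_ (isBigO_Q_mul_T1 hσ) (isBigO_Q_mul_dT1 hσ) ?_
  · have hQ := hasDerivAt_Q y
    have hr := hasDerivAt_rQ y
    have hc := Real.hasDerivAt_cos y
    have hs := Real.hasDerivAt_sin y
    refine (hQ.fun_mul ((((((hQ.fun_pow 2).const_mul 8).fun_sub
      ((hQ.fun_pow 4).const_mul 12)).fun_mul hr).fun_mul hc).fun_add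
      (((((hQ.fun_pow 2).const_sub 1).const_mul 32).fun_mul
        (((hQ.fun_pow 2).div_const 2).const_sub 1)).fun_mul hs))).congr_deriv ?_
    clear hQ hr hc hs
    have h := rQ_sq y
    push_cast
    grind
  · have hQ := hasDerivAt_Q y
    have hr := hasDerivAt_rQ y
    have hc := Real.hasDerivAt_cos y
    have hs := Real.hasDerivAt_sin y
    refine (hQ.fun_mul ((((((hQ.fun_pow 2).const_mul 4).const_sub 8).fun_add
      ((hQ.fun_pow 4).const_mul 2)).fun_mul hc).fun_add
      ((hr.fun_mul (((hQ.fun_pow 2).const_mul 6).const_add (-16))).fun_mul hs))).congr_deriv ?_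
    clear hQ hr hc hs
    have h := rQ_sq y
    push_cast
    grind
  · have hQ := hasDerivAt_Q y
    have hr := hasDerivAt_rQ y
    have hc := Real.hasDerivAt_cos y
    have hs := Real.hasDerivAt_sin y
    refine (hQ.fun_mul (((((((hQ.fun_pow 2).const_mul 6).const_sub (-8)).fun_add
      ((hQ.fun_pow 4).const_mul 10)).fun_mul hr).fun_mul hc).fun_add
      (((((hQ.fun_pow 2).const_mul 38).const_add (-24)).fun_sub
        ((hQ.fun_pow 4).const_mul 14)).fun_mul hs))).congr_deriv ?_
    clear hQ hr hc hs
    have h := rQ_sq y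
    push_cast
    grind
  · ring
  · exact isBigO_Q_mul_comp (F := fun p => 2 * p.1 ^ 2 * (3 * (1 - p.1 ^ 2) ^ 2 - 1) * p.2.2.1
      + 4 * p.2.1 * (2 - p.1 ^ 2) * (2 - 3 * p.1 ^ 2) * p.2.2.2.1) (by fun_prop)
  · exact isBigO_Q_mul_comp (F := fun p => (8 * p.1 ^ 2 - 12 * p.1 ^ 4) * p.2.1 * p.2.2.1
      + 32 * (1 - p.1 ^ 2) * (1 - p.1 ^ 2 / 2) * p.2.2.2.1) (by fun_prop)
  · exact isBigO_Q_mul_comp (F := fun p => (8 - 4 * p.1 ^ 2 + 2 * p.1 ^ 4) * p.2.2.1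
      + p.2.1 * (-16 + 6 * p.1 ^ 2) * p.2.2.2.1) (by fun_prop)
  · exact isBigO_Q_mul_comp (F := fun p => (-8 - 6 * p.1 ^ 2 + 10 * p.1 ^ 4) * p.2.1 * p.2.2.1
      + (-24 + 38 * p.1 ^ 2 - 14 * p.1 ^ 4) * p.2.2.2.1) (by fun_prop)
  · have h := (isBigO_Q_one.mul (isBigO_Qpow hσ)).mul isBigO_Q_one
    simp only [one_mul, mul_one] at h
    exact (h.const_mul_left (-((σ - 1) ^ 2 / (σ + 1)))).congr_left fun y => by ring

/-- The integrand collecting the terms of `Gamma0` that involve `T2`. -/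
lemma hasZeroIntegral_T2 {σ : ℝ} (hσ : 1 ≤ σ) : HasZeroIntegral fun y =>
    (Q y * (6 * Q y ^ 2 * (2 - Q y ^ 2) ^ 2 * Real.cos y
      + 4 * rQ y * (3 * Q y ^ 4 - 10 * Q y ^ 2 + 12) * Real.sin y)) * T2 σ y
    + (Q y * (4 * Q y ^ 2 * (4 - 3 * Q y ^ 2) * rQ y * Real.cos y
      + 16 * (2 - Q y ^ 2) * (1 - Q y ^ 2 / 2) * Real.sin y)) * dT2 σ y
    - (Q y * ((4 - 4 * Q y ^ 2 + 2 * Q y ^ 4) * Real.cos y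
      + rQ y * (-12 + 2 * Q y ^ 2) * Real.sin y)) *
      (σ * (σ - 1) / (σ + 1) * (Qpow σ y * Q y)) := by
  refine hasZeroIntegral_green (V := fun _ => 2) (ρ := Q)
    (db := fun y => Q y * ((32 + 16 * Q y ^ 2 - 84 * Q y ^ 4 + 36 * Q y ^ 6) * Real.cos y
      + (32 - 112 * Q y ^ 2 + 52 * Q y ^ 4) * rQ y * Real.sin y))
    (dh := fun y => Q y * ((-8 - 10 * Q y ^ 2 + 10 * Q y ^ 4) * rQ y * Real.cos y
      + (-16 + 22 * Q y ^ 2 - 6 * Q y ^ 4) * Real.sin y))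
    (ddh := fun y => Q y * ((-24 + 64 * Q y ^ 4 - 30 * Q y ^ 6) * Real.cos y
      + (-8 + 76 * Q y ^ 2 - 40 * Q y ^ 4) * rQ y * Real.sin y))
    (hasDerivAt_T2 hσ) (hasDerivAt_dT2 hσ)
    (fun y => ?_) (fun y => ?_) (fun y => ?_) (fun y => ?_) (by fun_prop) (by fun_prop)
    ?_ ?_ ?_ ?_ (isBigO_Q_mul_T2 hσ) (isBigO_Q_mul_dT2 hσ) ?_
  · have hQ := hasDerivAt_Q y
    have hr := hasDerivAt_rQ y
    have hc := Real.hasDerivAt_cos y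
    have hs := Real.hasDerivAt_sin y
    refine (hQ.fun_mul ((((((hQ.fun_pow 2).const_mul 4).fun_mul
      (((hQ.fun_pow 2).const_mul 3).const_sub 4)).fun_mul hr).fun_mul hc).fun_add
      (((((hQ.fun_pow 2).const_sub 2).const_mul 16).fun_mul
        (((hQ.fun_pow 2).div_const 2).const_sub 1)).fun_mul hs))).congr_deriv ?_
    clear hQ hr hc hs
    have h := rQ_sq y
    push_cast
    grind
  · have hQ := hasDerivAt_Q y
    have hr := hasDerivAt_rQ y
    have hc := Real.hasDerivAt_cos y
    have hs := Real.hasDerivAt_sin y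
    refine (hQ.fun_mul ((((((hQ.fun_pow 2).const_mul 4).const_sub 4).fun_add
      ((hQ.fun_pow 4).const_mul 2)).fun_mul hc).fun_add
      ((hr.fun_mul (((hQ.fun_pow 2).const_mul 2).const_add (-12))).fun_mul hs))).congr_deriv ?_
    clear hQ hr hc hs
    have h := rQ_sq y
    push_cast
    grind
  · have hQ := hasDerivAt_Q y
    have hr := hasDerivAt_rQ y
    have hc := Real.hasDerivAt_cos y
    have hs := Real.hasDerivAt_sin y
    refine (hQ.fun_mul (((((((hQ.fun_pow 2).const_mul 10).const_sub (-8)).fun_add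
      ((hQ.fun_pow 4).const_mul 10)).fun_mul hr).fun_mul hc).fun_add
      (((((hQ.fun_pow 2).const_mul 22).const_add (-16)).fun_sub
        ((hQ.fun_pow 4).const_mul 6)).fun_mul hs))).congr_deriv ?_
    clear hQ hr hc hs
    have h := rQ_sq y
    push_cast
    grind
  · ring
  · exact isBigO_Q_mul_comp (F := fun p => 6 * p.1 ^ 2 * (2 - p.1 ^ 2) ^ 2 * p.2.2.1
      + 4 * p.2.1 * (3 * p.1 ^ 4 - 10 * p.1 ^ 2 + 12) * p.2.2.2.1) (by fun_prop)
  · exact isBigO_Q_mul_comp (F := fun p => 4 * p.1 ^ 2 * (4 - 3 * p.1 ^ 2) * p.2.1 * p.2.2.1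
      + 16 * (2 - p.1 ^ 2) * (1 - p.1 ^ 2 / 2) * p.2.2.2.1) (by fun_prop)
  · exact isBigO_Q_mul_comp (F := fun p => (4 - 4 * p.1 ^ 2 + 2 * p.1 ^ 4) * p.2.2.1
      + p.2.1 * (-12 + 2 * p.1 ^ 2) * p.2.2.2.1) (by fun_prop)
  · exact isBigO_Q_mul_comp (F := fun p => (-8 - 10 * p.1 ^ 2 + 10 * p.1 ^ 4) * p.2.1 * p.2.2.1
      + (-16 + 22 * p.1 ^ 2 - 6 * p.1 ^ 4) * p.2.2.2.1) (by fun_prop)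
  · have h := (isBigO_Q_one.mul (isBigO_Qpow hσ)).mul isBigO_Q_one
    simp only [one_mul, mul_one] at h
    exact (h.const_mul_left (σ * (σ - 1) / (σ + 1))).congr_left fun y => by ring

lemma HasZeroIntegral.const_mul {w : ℝ → ℝ} (hw : HasZeroIntegral w) (a : ℝ) :
    HasZeroIntegral fun y => a * w y :=
  ⟨hw.1.const_mul a, by rw [integral_const_mul, hw.2, mul_zero]⟩

lemma hasDerivAt_Qpow_mul_pow (σ : ℝ) (n : ℕ) (y : ℝ) :
    HasDerivAt (fun y => Qpow σ y * Q y ^ n)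
      ((2 * σ - 1 + n) * (rQ y * (Qpow σ y * Q y ^ n))) y := by
  refine ((hasDerivAt_Qpow σ y).fun_mul ((hasDerivAt_Q y).fun_pow n)).congr_deriv ?_
  cases n with
  | zero => simp; ring
  | succ n => rw [Nat.add_sub_cancel]; push_cast; ring

lemma isBigO_Qpow_mul_comp {σ : ℝ} (hσ : 1 ≤ σ) {F : ℝ × ℝ × ℝ × ℝ × ℝ → ℝ}
    (hF : Continuous F) :
    (fun y => Qpow σ y * F (Q y, rQ y, Real.cos y, Real.sin y, primCos y)) =O[⊤] expWeight := by
  simpa using (isBigO_Qpow hσ).mul (isBigO_comp_one hF)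

lemma hasZeroIntegral_primCos {σ : ℝ} (hσ : 1 ≤ σ) : HasZeroIntegral fun y =>
    Qpow σ y * (2 * rQ y * Q y ^ 3 * primCos y + 1 / (σ + 1) * Q y ^ 4 * Real.cos y) := by
  have hs : σ + 1 ≠ 0 := by linarith
  refine hasZeroIntegral_of_hasDerivAt
    (W := fun y => Qpow σ y * (1 / (σ + 1) * Q y ^ 3 * primCos y)) (fun y => ?_) (by fun_prop)
    (isBigO_Qpow_mul_comp hσ (F := fun p => 1 / (σ + 1) * p.1 ^ 3 * p.2.2.2.2) (by fun_prop))
    (isBigO_Qpow_mul_comp hσ (F := fun p => 2 * p.2.1 * p.1 ^ 3 * p.2.2.2.2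
      + 1 / (σ + 1) * p.1 ^ 4 * p.2.2.1) (by fun_prop))
  refine ((hasDerivAt_Qpow σ y).fun_mul ((((hasDerivAt_Q y).fun_pow 3).const_mul
    (1 / (σ + 1))).fun_mul (hasDerivAt_primCos y))).congr_deriv ?_
  push_cast
  field_simp
  ring

lemma hasZeroIntegral_sin {σ : ℝ} (hσ : 1 ≤ σ) (n : ℕ) : HasZeroIntegral fun y =>
    Qpow σ y * ((2 * σ - 1 + n) * rQ y * Q y ^ n * Real.sin y + Q y ^ n * Real.cos y) := by
  refine hasZeroIntegral_of_hasDerivAt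
    (W := fun y => Qpow σ y * (Q y ^ n * Real.sin y)) (fun y => ?_) (by fun_prop)
    (isBigO_Qpow_mul_comp hσ (F := fun p => p.1 ^ n * p.2.2.2.1) (by fun_prop))
    (isBigO_Qpow_mul_comp hσ (F := fun p => (2 * σ - 1 + n) * p.2.1 * p.1 ^ n * p.2.2.2.1
      + p.1 ^ n * p.2.2.1) (by fun_prop))
  simp_rw [← mul_assoc]
  refine ((hasDerivAt_Qpow_mul_pow σ n y).fun_mul (Real.hasDerivAt_sin y)).congr_deriv ?_
  ring

lemma hasZeroIntegral_cos {σ : ℝ} (hσ : 1 ≤ σ) (n : ℕ) : HasZeroIntegral fun y =>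
    Qpow σ y * (((2 * σ - 1 + n) ^ 2 + 1) * Q y ^ n * Real.cos y
      - (2 * σ - 1 + n) * (2 * σ + n) / 2 * Q y ^ (n + 2) * Real.cos y) := by
  refine hasZeroIntegral_of_hasDerivAt
    (W := fun y => Qpow σ y * (Q y ^ n * ((2 * σ - 1 + n) * rQ y * Real.cos y + Real.sin y)))
    (fun y => ?_) (by fun_prop)
    (isBigO_Qpow_mul_comp hσ (F := fun p => p.1 ^ n * ((2 * σ - 1 + n) * p.2.1 * p.2.2.1
      + p.2.2.2.1)) (by fun_prop))
    (isBigO_Qpow_mul_comp hσ (F := fun p => ((2 * σ - 1 + n) ^ 2 + 1) * p.1 ^ n * p.2.2.1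
      - (2 * σ - 1 + n) * (2 * σ + n) / 2 * p.1 ^ (n + 2) * p.2.2.1) (by fun_prop))
  simp_rw [← mul_assoc (Qpow σ _) (Q _ ^ n)]
  refine ((hasDerivAt_Qpow_mul_pow σ n y).fun_mul ((((hasDerivAt_rQ y).const_mul
    (2 * σ - 1 + n : ℝ)).fun_mul (Real.hasDerivAt_cos y)).fun_add
      (Real.hasDerivAt_sin y))).congr_deriv ?_
  linear_combination (2 * σ - 1 + n) ^ 2 * Qpow σ y * Q y ^ n * Real.cos y * rQ_sq y

/-- The integrand of `Gamma0` in terms of the derivatives of `D0`, `T1` and `T2`. -/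
lemma Gamma0_integrand_eq {σ : ℝ} (hσ : 1 ≤ σ) (y : ℝ) :
    Q y ^ 2 * Delta4 σ y * Real.cos y + (2 * deriv Q y / Q y) * Delta5 σ y * Real.sin y =
    Q y ^ 2 * ((13 * Q y ^ 2 - 16) * Q y ^ 2 * D0 σ y
      - 8 * (rQ y * Q y) * Q y * dD0 σ y
      + 2 * Q y * (3 * (1 - Q y ^ 2) ^ 2 - 1) * T1 σ y
      + 6 * Q y * (2 - Q y ^ 2) ^ 2 * T2 σ y
      + 4 * (2 - 3 * Q y ^ 2) * (rQ y * Q y) * dT1 σ y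
      + 4 * (4 - 3 * Q y ^ 2) * (rQ y * Q y) * dT2 σ y
      + 2 * σ ^ 2 * Qpow σ y
      - (4 * (σ + 2) / (σ + 1) + (2 * σ + 1) ^ 2) * (Qpow σ y * Q y ^ 2)
      + (8 / (σ + 1) + (σ + 1) * (2 * σ + 1)) * (Qpow σ y * Q y ^ 4)) * Real.cos y
    + 2 * rQ y * ((2 - 30 * Q y ^ 2 + 29 * Q y ^ 4 - 8 * Q y ^ 6) * D0 σ y
      - 8 * Q y ^ 3 * (rQ y * Q y) * dD0 σ y
      + 2 * Q y * (2 - Q y ^ 2) * (2 - 3 * Q y ^ 2) * T1 σ y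
      + 2 * Q y * (3 * Q y ^ 4 - 10 * Q y ^ 2 + 12) * T2 σ y
      + 16 * (1 - Q y ^ 2) * (rQ y * Q y) * dT1 σ y
      + 8 * (2 - Q y ^ 2) * (rQ y * Q y) * dT2 σ y
      + 2 * σ * (σ + 1) * Qpow σ y
      - (16 / (σ + 1) + 2 * σ + (2 * σ + 1) ^ 2) * (Qpow σ y * Q y ^ 2)
      + (4 * (4 - σ) / (σ + 1) + (σ + 1) * (2 * σ + 1)) * (Qpow σ y * Q y ^ 4)
      - (4 / (σ + 1)) * (Qpow σ y * Q y ^ 6)) * Real.sin y := by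
  rw [Delta4, Delta5, deriv_Q, (hasDerivAt_D0 hσ y).deriv, (hasDerivAt_T1 hσ y).deriv,
    (hasDerivAt_T2 hσ y).deriv, Q_rpow_eq σ y 2 (2 * σ + 1) (by push_cast; ring),
    Q_rpow_eq σ y 4 (2 * σ + 3) (by push_cast; ring),
    Q_rpow_eq σ y 6 (2 * σ + 5) (by push_cast; ring), ← mul_assoc 2 (rQ y),
    mul_div_cancel_right₀ _ (Q_pos y).ne', Qpow]

lemma hasZeroIntegral_Gamma0_sub {σ : ℝ} (hσ : 1 < σ) : HasZeroIntegral fun y =>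
    (Q y ^ 2 * Delta4 σ y * Real.cos y + (2 * deriv Q y / Q y) * Delta5 σ y * Real.sin y)
      - (σ - 1) * ((8 * σ ^ 3 - 12 * σ ^ 2 + 24 * σ - 16) / ((2 * σ - 1) * (σ + 1)))
        * (Qpow σ y * Real.cos y) := by
  have hs : σ + 1 ≠ 0 := by linarith
  have hm0 : 2 * σ - 1 ≠ 0 := by linarith
  have hm1 : 2 * σ + 1 ≠ 0 := by linarith
  have hm2 : 2 * σ + 3 ≠ 0 := by linarith
  have hm3 : 2 * σ + 5 ≠ 0 := by linarith
  have hs0 : σ ≠ 0 := by linarith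
  have hs2 : σ + 2 ≠ 0 := by linarith
  obtain ⟨k, hk⟩ : ∃ k, k = -((σ - 1) ^ 2 / (σ + 1)) := ⟨_, rfl⟩
  obtain ⟨l, hl⟩ : ∃ l, l = σ * (σ - 1) / (σ + 1) := ⟨_, rfl⟩
  obtain ⟨t0, ht0⟩ : ∃ t, t = 4 * σ * (σ + 1) / (2 * σ - 1) := ⟨_, rfl⟩
  obtain ⟨t1, ht1⟩ : ∃ t, t = (-2 * (16 / (σ + 1) + 2 * σ + (2 * σ + 1) ^ 2) + 2
    - 16 * k - 12 * l) / (2 * σ + 1) := ⟨_, rfl⟩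
  obtain ⟨t2, ht2⟩ : ∃ t, t = (2 * (4 * (4 - σ) / (σ + 1) + (σ + 1) * (2 * σ + 1)) + 26 / 3
    + 6 * k + 2 * l) / (2 * σ + 3) := ⟨_, rfl⟩
  obtain ⟨t3, ht3⟩ : ∃ t, t = (-2 * (4 / (σ + 1)) - 16 / 3) / (2 * σ + 5) := ⟨_, rfl⟩
  obtain ⟨g2, hg2⟩ : ∃ g, g = -((8 / (σ + 1) + (σ + 1) * (2 * σ + 1)) + 5 / 3 + 2 * k + 2 * l
    - t3) / ((2 * σ + 3) * (σ + 2)) := ⟨_, rfl⟩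
  obtain ⟨g1, hg1⟩ : ∃ g, g = -(-(4 * (σ + 2) / (σ + 1) + (2 * σ + 1) ^ 2) - 25 / 3 - 4 * k
    - 4 * l + 8 / 3 * (1 / (σ + 1)) - t2 - g2 * ((2 * σ + 3) ^ 2 + 1)) /
      ((2 * σ + 1) * (σ + 1)) := ⟨_, rfl⟩
  obtain ⟨g0, hg0⟩ : ∃ g, g = -(2 * σ ^ 2 + 8 * k + 4 * l - t1 - g1 * ((2 * σ + 1) ^ 2 + 1)) /
      ((2 * σ - 1) * σ) := ⟨_, rfl⟩
  obtain ⟨R, hR⟩ : ∃ R, R = (σ - 1) * ((8 * σ ^ 3 - 12 * σ ^ 2 + 24 * σ - 16) /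
    ((2 * σ - 1) * (σ + 1))) := ⟨_, rfl⟩
  have e : t0 + g0 * ((2 * σ - 1) ^ 2 + 1) + R = 0 := by
    rw [hR, hg0, hg1, hg2, ht0, ht1, ht2, ht3, hk, hl]
    field_simp
    ring
  rw [eq_div_iff (by positivity)] at ht0 ht1 ht2 ht3 hg0 hg1 hg2
  have hW := ((((hasZeroIntegral_D0 hσ.le).add (hasZeroIntegral_T1 hσ.le)).add
    (hasZeroIntegral_T2 hσ.le)).add ((hasZeroIntegral_primCos hσ.le).const_mul (-8 / 3))).add
    (((((hasZeroIntegral_sin hσ.le 0).const_mul t0).add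
    ((hasZeroIntegral_sin hσ.le 2).const_mul t1)).add
    (((hasZeroIntegral_sin hσ.le 4).const_mul t2).add
    ((hasZeroIntegral_sin hσ.le 6).const_mul t3))).add
    ((((hasZeroIntegral_cos hσ.le 0).const_mul g0).add
    ((hasZeroIntegral_cos hσ.le 2).const_mul g1)).add
    ((hasZeroIntegral_cos hσ.le 4).const_mul g2)))
  convert hW using 2 with y
  rw [Gamma0_integrand_eq hσ.le, ← hR, ← hk, ← hl]
  push_cast
  clear hW hR hk hl
  linear_combination (-16 * Q y ^ 4 * Real.sin y * dD0 σ y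
    + 32 * (1 - Q y ^ 2) * Q y * Real.sin y * dT1 σ y
    + 16 * (2 - Q y ^ 2) * Q y * Real.sin y * dT2 σ y) * rQ_sq y
    - Qpow σ y * Real.cos y * e
    - rQ y * Qpow σ y * Real.sin y * (ht0 + Q y ^ 2 * ht1 + Q y ^ 4 * ht2 + Q y ^ 6 * ht3)
    + Qpow σ y * Real.cos y * (Q y ^ 2 * hg0 + Q y ^ 4 * hg1 + Q y ^ 6 * hg2)

lemma Gamma0_eq {σ : ℝ} (hσ : 1 < σ) : Gamma0 σ =
    (σ - 1) * ((8 * σ ^ 3 - 12 * σ ^ 2 + 24 * σ - 16) / ((2 * σ - 1) * (σ + 1)))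
      * ∫ y, Qpow σ y * Real.cos y := by
  obtain ⟨hi, h0⟩ := hasZeroIntegral_Gamma0_sub hσ
  have hX : Integrable fun y => Qpow σ y * Real.cos y :=
    integrable_of_isBigO_expWeight (by fun_prop)
      (isBigO_Qpow_mul_comp hσ.le (F := fun p => p.2.2.1) (by fun_prop))
  have hX' := hX.const_mul
    ((σ - 1) * ((8 * σ ^ 3 - 12 * σ ^ 2 + 24 * σ - 16) / ((2 * σ - 1) * (σ + 1))))
  have h := integral_add hi hX'
  rw [h0, zero_add, integral_const_mul] at h
  rw [← h, Gamma0]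
  exact integral_congr_ae (Eventually.of_forall fun y => (sub_add_cancel _ _).symm)

lemma tendsto_integral_Qpow_mul_cos :
    Tendsto (fun σ => ∫ y, Qpow σ y * Real.cos y) (𝓝[>] 1) (𝓝 (∫ y, Q y * Real.cos y)) := by
  have hb : (fun y => Q y + Q y ^ 3) =O[⊤] expWeight := by
    have h := isBigO_Q.mul (isBigO_comp_one (F := fun p => 1 + p.1 ^ 2) (by fun_prop))
    simp only [mul_one] at h
    exact h.congr_left fun y => by ring
  refine tendsto_integral_filter_of_dominated_convergence (fun y => Q y + Q y ^ 3)
    (Eventually.of_forall fun σ => Continuous.aestronglyMeasurable (by fun_prop)) ?_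
    (integrable_of_isBigO_expWeight (by fun_prop) hb) (Eventually.of_forall fun y => ?_)
  · filter_upwards [Ioo_mem_nhdsGT one_lt_two] with σ hσ
    refine Eventually.of_forall fun y => ?_
    have hQ := Q_pos y
    rw [norm_mul, Real.norm_of_nonneg (Qpow_pos σ y).le]
    refine (mul_le_of_le_one_right (Qpow_pos σ y).le (Real.abs_cos_le_one y)).trans ?_
    rw [Qpow]
    rcases le_total (Q y) 1 with h | h
    · have := Real.rpow_le_rpow_of_exponent_ge hQ h (show (1 : ℝ) ≤ 2 * σ - 1 by linarith [hσ.1])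
      rw [Real.rpow_one] at this
      have := pow_pos hQ 3
      linarith
    · have := Real.rpow_le_rpow_of_exponent_le h
        (show 2 * σ - 1 ≤ ((3 : ℕ) : ℝ) by push_cast; linarith [hσ.2])
      rw [Real.rpow_natCast] at this
      linarith
  · refine Tendsto.mul_const _ ?_
    have hc : Continuous fun σ => Qpow σ y := by
      unfold Qpow
      exact continuous_const.rpow (by fun_prop) fun σ => Or.inl (Q_pos y).ne'
    have h := (hc.tendsto 1).mono_left (nhdsWithin_le_nhds (s := Set.Ioi 1))
    have h1 : Qpow 1 y = Q y := by
      rw [Qpow]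
      norm_num
    rwa [h1] at h

lemma ofReal_exp_cpow (a : ℝ) (u : ℂ) : ((Real.exp a : ℝ) : ℂ) ^ u = Complex.exp (a * u) := by
  rw [Complex.cpow_def_of_ne_zero (by exact_mod_cast (Real.exp_pos a).ne'), ← Complex.ofReal_log
    (Real.exp_pos a).le, Real.log_exp]

lemma sigmoid_two_mul (y : ℝ) :
    Real.sigmoid (2 * y) = Real.exp (y - Real.log (2 * Real.cosh y)) := by
  have := Real.cosh_pos y
  rw [Real.exp_sub, Real.exp_log (by positivity), Real.sigmoid_def, Real.cosh_eq, Real.exp_neg,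
    Real.exp_neg, two_mul, Real.exp_add]
  have := Real.exp_pos y
  field_simp

/-- The Fourier transform of `1 / cosh` as a Beta integral. -/
lemma betaIntegral_eq_integral_exp_div_cosh :
    Complex.betaIntegral (1 / 2 + Complex.I / 2) (1 / 2 - Complex.I / 2) =
      ∫ y : ℝ, Complex.exp (y * Complex.I) / Real.cosh y := by
  rw [Complex.betaIntegral, intervalIntegral.integral_of_le zero_le_one,
    integral_Ioc_eq_integral_Ioo]
  have hr : (fun y => Real.sigmoid (2 * y)) '' Set.univ = Set.Ioo 0 1 := by
    rw [Set.image_univ, ← Real.range_sigmoid]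
    exact (mul_left_surjective₀ (two_ne_zero' ℝ)).range_comp Real.sigmoid
  have hd (y : ℝ) : HasDerivAt (fun y => Real.sigmoid (2 * y))
      (Real.sigmoid (2 * y) * (1 - Real.sigmoid (2 * y)) * 2) y := by
    refine HasDerivAt.congr_deriv (HasDerivAt.comp (h₂ := Real.sigmoid) (h := fun y => 2 * y) y
      (Real.hasDerivAt_sigmoid (2 * y)) ((hasDerivAt_id y).const_mul 2)) ?_
    rw [mul_one]
  rw [← hr, integral_image_eq_integral_abs_deriv_smul MeasurableSet.univ
    (fun y _ => (hd y).hasDerivWithinAt)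
    (fun x _ y _ h => by simpa using Real.sigmoid_injective h), setIntegral_univ]
  refine integral_congr_ae (Eventually.of_forall fun y => ?_)
  have hc : ((2 * Real.cosh y : ℝ) : ℂ) = Complex.exp (Real.log (2 * Real.cosh y)) := by
    rw [← Complex.ofReal_exp, Real.exp_log (by have := Real.cosh_pos y; positivity)]
  have hc0 : (Real.cosh y : ℂ) ≠ 0 := by exact_mod_cast (Real.cosh_pos y).ne'
  have h1 : 1 - Real.sigmoid (2 * y) = Real.exp (-y - Real.log (2 * Real.cosh y)) := by
    rw [← Real.sigmoid_neg, ← mul_neg, sigmoid_two_mul, Real.cosh_neg]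
  have h1' : 1 - ((Real.sigmoid (2 * y) : ℝ) : ℂ) =
      ((Real.exp (-y - Real.log (2 * Real.cosh y)) : ℝ) : ℂ) := by
    rw [← h1]
    push_cast
    rfl
  have hp := Real.sigmoid_pos (2 * y)
  have hp1 := sub_pos.2 (Real.sigmoid_lt_one (2 * y))
  beta_reduce
  rw [abs_of_pos (by positivity), h1', h1, sigmoid_two_mul, ofReal_exp_cpow, ofReal_exp_cpow,
    eq_div_iff hc0, Complex.real_smul]
  push_cast at hc ⊢
  rw [mul_right_comm _ (2 : ℂ)]
  have h2 : (2 : ℂ) * Complex.cosh y ≠ 0 := by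
    rw [hc]
    exact Complex.exp_ne_zero _
  set L : ℂ := ((Real.log (2 * Real.cosh y) : ℝ) : ℂ)
  calc _ = (Complex.exp (y - L) * Complex.exp (-y - L) *
        (Complex.exp ((y - L) * (1 / 2 + Complex.I / 2 - 1)) *
          Complex.exp ((-y - L) * (1 / 2 - Complex.I / 2 - 1)))) * (2 * Complex.cosh y) := by ring
    _ = _ := by
      rw [hc, ← Complex.exp_add, ← Complex.exp_add, ← Complex.exp_add, ← Complex.exp_add]
      congr 1
      ring

lemma integral_exp_div_cosh :
    ∫ y : ℝ, Complex.exp (y * Complex.I) / Real.cosh y = Real.pi / Real.cosh (Real.pi / 2) := by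
  rw [← betaIntegral_eq_integral_exp_div_cosh]
  have h := Complex.Gamma_mul_Gamma_eq_betaIntegral (s := 1 / 2 + Complex.I / 2)
    (t := 1 / 2 - Complex.I / 2) (by simp) (by simp)
  rw [show (1 / 2 + Complex.I / 2) + (1 / 2 - Complex.I / 2) = 1 by ring,
    Complex.Gamma_one, one_mul,
    show 1 / 2 - Complex.I / 2 = 1 - (1 / 2 + Complex.I / 2) by ring,
    Complex.Gamma_mul_Gamma_one_sub] at h
  rw [show 1 / 2 - Complex.I / 2 = 1 - (1 / 2 + Complex.I / 2) by ring, ← h,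
    show (Real.pi : ℂ) * (1 / 2 + Complex.I / 2) = (Real.pi / 2 : ℂ) * Complex.I + Real.pi / 2 by
      ring, Complex.sin_add_pi_div_two, Complex.cos_mul_I]
  push_cast
  rfl

lemma integral_Q_mul_cos :
    ∫ y, Q y * Real.cos y = Real.sqrt 2 * Real.pi / Real.cosh (Real.pi / 2) := by
  have hi : Integrable fun y : ℝ => Complex.exp (y * Complex.I) / Real.cosh y := by
    refine (integrable_of_isBigO_expWeight continuous_Q isBigO_Q).mono'
      (Continuous.aestronglyMeasurable ?_) (Eventually.of_forall fun y => ?_)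
    · refine Continuous.div (by fun_prop) (by fun_prop) fun y => ?_
      exact_mod_cast (Real.cosh_pos y).ne'
    · rw [norm_div, Complex.norm_exp_ofReal_mul_I, Complex.norm_real,
        Real.norm_of_nonneg (Real.cosh_pos y).le, Q]
      have := Real.cosh_pos y
      gcongr
      exact Real.one_le_sqrt.2 one_le_two
  have h := congrArg Complex.re integral_exp_div_cosh
  rw [← Complex.reCLM_apply, ← Complex.reCLM.integral_comp_comm hi, ← Complex.ofReal_div,
    Complex.ofReal_re] at h
  rw [mul_div_assoc, ← h, ← integral_const_mul]
  refine integral_congr_ae (Eventually.of_forall fun y => ?_)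
  simp only [Complex.reCLM_apply, Complex.div_ofReal_re, Complex.exp_ofReal_mul_I_re, Q]
  ring

theorem stmt18 :
    Filter.Tendsto (fun σ : ℝ => Gamma0 σ / (σ - 1)) (nhdsWithin 1 (Set.Ioi 1))
      (nhds (2 * Real.sqrt 2 * Real.pi / Real.cosh (Real.pi / 2))) ∧
    ∃ σ₀ : ℝ, 1 < σ₀ ∧ ∀ σ ∈ Set.Ioo (1 : ℝ) σ₀, 0 < Gamma0 σ := by
  have hlim : Tendsto (fun σ : ℝ => Gamma0 σ / (σ - 1)) (𝓝[>] 1)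
      (𝓝 (2 * Real.sqrt 2 * Real.pi / Real.cosh (Real.pi / 2))) := by
    have hR : Tendsto (fun σ : ℝ => (8 * σ ^ 3 - 12 * σ ^ 2 + 24 * σ - 16) /
        ((2 * σ - 1) * (σ + 1))) (𝓝[>] 1) (𝓝 2) := by
      have hc : ContinuousAt (fun σ : ℝ => (8 * σ ^ 3 - 12 * σ ^ 2 + 24 * σ - 16) /
          ((2 * σ - 1) * (σ + 1))) 1 :=
        ContinuousAt.div (by fun_prop) (by fun_prop) (by norm_num)
      have h := hc.tendsto.mono_left (nhdsWithin_le_nhds (s := Set.Ioi 1))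
      norm_num at h
      exact h
    have h := hR.mul tendsto_integral_Qpow_mul_cos
    rw [integral_Q_mul_cos, ← mul_div_assoc, ← mul_assoc] at h
    refine h.congr' ?_
    filter_upwards [self_mem_nhdsWithin] with σ hσ
    rw [Gamma0_eq hσ, mul_assoc, mul_div_cancel_left₀ _ (sub_pos.2 hσ).ne']
  refine ⟨hlim, ?_⟩
  have hpos : 0 < 2 * Real.sqrt 2 * Real.pi / Real.cosh (Real.pi / 2) := by
    have := Real.cosh_pos (Real.pi / 2)
    positivity
  obtain ⟨σ₀, h1, h⟩ := (mem_nhdsGT_iff_exists_Ioo_subset).1 (hlim.eventually (lt_mem_nhds hpos))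
  refine ⟨σ₀, h1, fun σ hσ => ?_⟩
  exact (div_pos_iff_of_pos_right (sub_pos.2 hσ.1)).1 (h hσ)
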